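/- Let U, D(α) and the L²₀ boundary condition be as in the context. Then for every α ∈ ℂ and each k ∈ {K, −K} (with K = 4π/3) there exists a smooth, not identically zero function u : ℂ → ℂ² satisfying the L²₀ boundary condition and D(α)u = k·u. (These are the protected Dirac points at K and K': the points ±K + Λ* always belong to the spectrum of D(α) on L²₀.) -/

import Mathlib

noncomputable section

open Complex ComplexConjugate

/-- ω = exp(2πi/3). -/
def ω : ℂ := Complex.exp (2 * Real.pi * Complex.I / 3)

/-- The lattice Λ = ℤ + ωℤ. -/
def Lam : Set ℂ := {z : ℂ | ∃ m n : ℤ, z = (m : ℂ) + (n : ℂ) * ω}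

/-- The dual lattice Λ* = (4πi/√3)Λ. -/
def LamS : Set ℂ :=
  {z : ℂ | ∃ m n : ℤ,
    z = 4 * (Real.pi : ℂ) * Complex.I / (Real.sqrt 3 : ℂ) * ((m : ℂ) + (n : ℂ) * ω)}

/-- ⟨z,w⟩ = Re (z ⬝ conj w). -/
def pairing (z w : ℂ) : ℝ := (z * conj w).re

/-- K = 4π/3. -/
def Kpt : ℂ := 4 * (Real.pi : ℂ) / 3

/-- 2D_z̄ u = −i(∂ₓu + i∂9u), via the real Fréchet derivative. -/
def twoDbar (u : ℂ → ℂ) (z : ℂ) : ℂ :=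
  -Complex.I * (fderiv ℝ u z 1 + Complex.I * fderiv ℝ u z Complex.I)

/-- The magnetic chiral Dirac operator D_B(α). -/
def DB (U : ℂ → ℂ) (α B : ℂ) (u : ℂ → ℂ × ℂ) (z : ℂ) : ℂ × ℂ :=
  (twoDbar (fun w => (u w).1) z + α * U z * (u z).2 + B * (u z).1,
   α * U (-z) * (u z).1 + twoDbar (fun w => (u w).2) z - B * (u z).2)

/-- The chiral Dirac operator D(α) (no magnetic field). -/
def Dop (U : ℂ → ℂ) (α : ℂ) (u : ℂ → ℂ × ℂ) (z : ℂ) : ℂ × ℂ :=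
  (twoDbar (fun w => (u w).1) z + α * U z * (u z).2,
   α * U (-z) * (u z).1 + twoDbar (fun w => (u w).2) z)

/-- The L²₀ boundary condition. -/
def BC (u : ℂ → ℂ × ℂ) : Prop :=
  ∀ γ ∈ Lam, ∀ z : ℂ,
    u (z + γ) = (Complex.exp (-Complex.I * (pairing γ Kpt : ℂ)) * (u z).1,
                 Complex.exp (Complex.I * (pairing γ Kpt : ℂ)) * (u z).2)

/-- Hypotheses on the potential U. -/
def IsPotential (U : ℂ → ℂ) : Prop :=
  ContDiff ℝ (⊤ : ℕ∞) U ∧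
  (∀ γ ∈ Lam, ∀ z : ℂ,
    U (z + γ) = Complex.exp (-2 * Complex.I * (pairing γ Kpt : ℂ)) * U z) ∧
  (∀ z : ℂ, U (ω * z) = ω * U z) ∧
  (∀ z : ℂ, conj (U (conj z)) = - U (-z))



open Filter Topology

abbrev L1 (ι : Type) := lp (fun _ : ι => ℂ) 1

lemma L1_hasSum {ι : Type} (f : L1 ι) : HasSum (fun i => ‖f i‖) ‖f‖ := by
  have := lp.hasSum_norm (p := 1) (by simp) f
  simpa using this

lemma L1_mem {ι : Type} {f : ι → ℂ} (hf : Summable fun i => ‖f i‖) : Memℓp f 1 :=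
  memℓp_gen (by simpa using hf)

lemma L1_eval {ι : Type} (i : ι) (f : L1 ι) : lp.evalCLM ℂ (fun _ : ι => ℂ) 1 i f = f i := rfl

lemma exists_clm {ι : Type} (v : ι → L1 ι) (C : ℝ) (hC0 : 0 ≤ C) (hC : ∀ j, ‖v j‖ ≤ C) :
    ∃ A : L1 ι →L[ℂ] L1 ι, ‖A‖ ≤ C ∧ ∀ f : L1 ι, HasSum (fun j => f j • v j) (A f) := by
  have hs : ∀ f : L1 ι, Summable (fun j => ‖f j‖ * C) := fun f =>
    (L1_hasSum f).summable.mul_right C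
  have hle : ∀ (f : L1 ι) j, ‖f j • v j‖ ≤ ‖f j‖ * C := fun f j => by
    rw [norm_smul]; exact mul_le_mul_of_nonneg_left (hC j) (norm_nonneg _)
  have hS : ∀ f : L1 ι, Summable (fun j => f j • v j) := fun f =>
    Summable.of_norm_bounded (hs f) (hle f)
  let A0 : L1 ι →ₗ[ℂ] L1 ι :=
    { toFun := fun f => ∑' j, f j • v j
      map_add' := fun f g => by
        rw [← (hS f).tsum_add (hS g)]
        exact tsum_congr fun j => by rw [lp.coeFn_add, Pi.add_apply, add_smul]
      map_smul' := fun c f => by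
        rw [RingHom.id_apply, ← (hS f).tsum_const_smul c]
        exact tsum_congr fun j => by
          rw [lp.coeFn_smul, Pi.smul_apply, smul_eq_mul, mul_smul] }
  have hb : ∀ f, ‖A0 f‖ ≤ C * ‖f‖ := fun f => by
    have h1 := tsum_of_norm_bounded ((L1_hasSum f).mul_right C) (hle f)
    rw [mul_comm]; exact h1
  refine ⟨A0.mkContinuous C hb, A0.mkContinuous_norm_le hC0 hb, fun f => (hS f).hasSum⟩

lemma compact_clm {ι : Type} (v : ι → L1 ι)
    (hfin : ∀ ε > 0, {j | ε ≤ ‖v j‖}.Finite)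
    (A : L1 ι →L[ℂ] L1 ι) (hA : ∀ f : L1 ι, HasSum (fun j => f j • v j) (A f)) :
    IsCompactOperator A := by
  classical
  have key : ∀ ε > 0, ∃ F : L1 ι →L[ℂ] L1 ι, IsCompactOperator F ∧ ‖A - F‖ ≤ ε := by
    intro ε hε
    let S := (hfin ε hε).toFinset
    let F : L1 ι →L[ℂ] L1 ι :=
      ∑ j ∈ S, (ContinuousLinearMap.toSpanSingleton ℂ (v j)).comp
        (lp.evalCLM ℂ (fun _ : ι => ℂ) 1 j)
    have hF : IsCompactOperator F := by
      have : F ∈ compactOperator (RingHom.id ℂ) (L1 ι) (L1 ι) := by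
        refine Submodule.sum_mem _ fun j _ => ?_
        have h1 : IsCompactOperator (lp.evalCLM ℂ (fun _ : ι => ℂ) 1 j) :=
          isCompactOperator_of_locallyCompactSpace_dom _
        exact h1.clm_comp (ContinuousLinearMap.toSpanSingleton ℂ (v j))
      exact this
    obtain ⟨B, hB1, hB2⟩ := exists_clm (fun j => if j ∈ S then 0 else v j) ε hε.le (by
      intro j
      by_cases hj : j ∈ S
      · simp [hj, hε.le]
      · simp only [hj, if_false]
        simp only [S, Set.Finite.mem_toFinset, Set.mem_ofPred_eq, not_le] at hj
        exact hj.le)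
    refine ⟨F, hF, ?_⟩
    have : A - F = B := by
      ext1 f
      have h1 : HasSum (fun j => if j ∈ S then f j • v j else 0) (F f) := by
        have : HasSum (fun j => if j ∈ S then f j • v j else 0)
            (∑ j ∈ S, if j ∈ S then f j • v j else 0) :=
          hasSum_sum_of_ne_finset_zero (by intro b hb; simp [hb])
        convert this using 1
        simp only [F, _root_.sum_apply, ContinuousLinearMap.comp_apply, L1_eval,
          ContinuousLinearMap.toSpanSingleton_apply]
        exact Finset.sum_congr rfl fun j hj => by simp [hj]
      have h2 := (hA f).sub h1
      refine h2.unique ?_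
      convert hB2 f using 2 with j
      by_cases hj : j ∈ S <;> simp [hj]
    rw [this]; exact hB1
  choose F hF1 hF2 using fun n : ℕ => key (1 / ((n : ℝ) + 1)) (by positivity)
  refine isCompactOperator_of_tendsto (l := atTop) (F := F) ?_ (Eventually.of_forall hF1)
  rw [tendsto_iff_norm_sub_tendsto_zero]
  refine squeeze_zero (fun _ => norm_nonneg _) (fun n => ?_) tendsto_one_div_add_atTop_nhds_zero_nat
  rw [norm_sub_rev]; exact hF2 n

/-- The discrete index argument. -/
lemma discrete_index {ι : Type} (μ : ι → ℂ) (σ : ι ≃ ι) (ζ : ℂ) (hζ0 : ζ ≠ 0) (hζ1 : ζ ≠ 1)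
    (V : ι → ι → ℂ) (hμσ : ∀ i, μ (σ i) = ζ * μ i) (hVσ : ∀ i j, V (σ i) (σ j) = ζ * V i j)
    (i0 : ι) (hi0 : ∀ i, μ i = 0 ↔ i = i0) (hfin : ∀ R : ℝ, {i | ‖μ i‖ ≤ R}.Finite)
    (C : ℝ) (hVs : ∀ j, Summable fun i => ‖V i j‖) (hVC : ∀ j, ∑' i, ‖V i j‖ ≤ C) :
    ∃ g : ι → ℂ, (Summable fun i => ‖g i‖) ∧ (∃ i, g i ≠ 0) ∧
      ∀ i, HasSum (fun j => V i j * g j) (-(μ i * g i)) := by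
  classical
  have hC0 : 0 ≤ C := le_trans (tsum_nonneg fun _ => norm_nonneg _) (hVC i0)
  have hσ0 : σ i0 = i0 := by
    rw [← hi0, hμσ, (hi0 i0).2 rfl, mul_zero]
  let col : ι → L1 ι := fun j => ⟨fun i => V i j, L1_mem (hVs j)⟩
  have hcol : ∀ j, ‖col j‖ ≤ C := fun j => by
    rw [← (L1_hasSum (col j)).tsum_eq]; exact hVC j
  let v : ι → L1 ι := fun j => (μ j)⁻¹ • col j
  have hvn : ∀ j, ‖v j‖ ≤ ‖μ j‖⁻¹ * C := fun j => by
    rw [norm_smul, norm_inv]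
    exact mul_le_mul_of_nonneg_left (hcol j) (by positivity)
  have hvfin : ∀ ε > 0, {j | ε ≤ ‖v j‖}.Finite := by
    intro ε hε
    refine (hfin (C / ε)).subset fun j hj => ?_
    simp only [Set.mem_ofPred_eq] at hj ⊢
    have h1 := hj.trans (hvn j)
    by_cases h0 : ‖μ j‖ = 0
    · rw [h0]; positivity
    · have : 0 < ‖μ j‖ := lt_of_le_of_ne (norm_nonneg _) (Ne.symm h0)
      rw [le_div_iff₀ hε]
      rw [inv_mul_eq_div, le_div_iff₀ this] at h1
      linarith
  obtain ⟨D, hD⟩ : ∃ D, 0 ≤ D ∧ ∀ j, ‖v j‖ ≤ D := by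
    have hf := hvfin 1 one_pos
    obtain ⟨D, hD⟩ := (hf.image fun j => ‖v j‖).bddAbove
    refine ⟨max D 1, by positivity, fun j => ?_⟩
    by_cases h : 1 ≤ ‖v j‖
    · exact (hD ⟨j, h, rfl⟩).trans (le_max_left _ _)
    · exact (not_le.1 h).le.trans (le_max_right _ _)
  obtain ⟨A, -, hA⟩ := exists_clm v D hD.1 hD.2
  have hAc := compact_clm v hvfin A hA
  -- coordinates
  have hAi : ∀ (f : L1 ι) i, HasSum (fun j => V i j * ((μ j)⁻¹ * f j)) (A f i) := by
    intro f i
    have := (lp.evalCLM ℂ (fun _ : ι => ℂ) 1 i).hasSum (hA f)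
    rw [L1_eval] at this
    refine this.congr_fun ?_
    intro j
    simp only [map_smul, v, L1_eval, smul_eq_mul, col]
    ring
  -- the symmetric subspace
  let Y : Submodule ℂ (L1 ι) :=
    { carrier := {f | ∀ i, f (σ i) = ζ * f i}
      add_mem' := fun {a b} ha hb i => by
        simp only [lp.coeFn_add, Pi.add_apply, ha i, hb i]; ring
      zero_mem' := fun i => by simp
      smul_mem' := fun c f hf i => by
        simp only [lp.coeFn_smul, Pi.smul_apply, hf i, smul_eq_mul]; ring }
  have hYc : IsClosed (Y : Set (L1 ι)) := by
    have : (Y : Set (L1 ι)) = ⋂ i, {f : L1 ι | lp.evalCLM ℂ (fun _ : ι => ℂ) 1 (σ i) f =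
        ζ * lp.evalCLM ℂ (fun _ : ι => ℂ) 1 i f} := by
      ext f; simp only [Set.mem_iInter]; rfl
    rw [this]
    exact isClosed_iInter fun i => isClosed_eq (by fun_prop) (by fun_prop)
  have hAY : ∀ f ∈ Y, A f ∈ Y := by
    intro f hf i
    have h1 := hAi f (σ i)
    rw [← σ.hasSum_iff] at h1
    have h2 := (hAi f i).mul_left ζ
    refine h1.unique (h2.congr_fun ?_)
    intro j
    simp only [Function.comp_apply, hVσ, hμσ, hf j]
    by_cases h0 : μ j = 0
    · simp [h0]
    · field_simp
  have hY0 : ∀ f ∈ Y, f i0 = 0 := by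
    intro f hf
    have := hf i0
    rw [hσ0] at this
    have h2 : (1 - ζ) * f i0 = 0 := by linear_combination this
    rcases mul_eq_zero.1 h2 with h | h
    · exact absurd (sub_eq_zero.1 h).symm hζ1
    · exact h
  have : CompleteSpace Y := hYc.completeSpace_coe
  let B : Y →L[ℂ] Y := A.restrict hAY
  have hB : IsCompactOperator B := hAc.restrict (f := (A : L1 ι →ₗ[ℂ] L1 ι)) hAY hYc
  have hμinv : ∀ f ∈ Y, ∀ i, μ i * ((μ i)⁻¹ * f i) = f i := by
    intro f hf i
    by_cases h0 : μ i = 0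
    · rw [(hi0 i).1 h0, hY0 f hf]; simp
    · field_simp
  have hTsum : ∀ f : L1 ι, Summable fun i => ‖(μ i)⁻¹ * f i‖ := by
    intro f
    obtain ⟨M, hM⟩ := ((hfin 1).image fun i => ‖(μ i)⁻¹‖).bddAbove
    refine Summable.of_nonneg_of_le (fun _ => norm_nonneg _) (fun i => ?_)
      ((L1_hasSum f).summable.mul_left (max M 1))
    rw [norm_mul]
    refine mul_le_mul_of_nonneg_right ?_ (norm_nonneg _)
    by_cases h : ‖μ i‖ ≤ 1
    · exact (hM ⟨i, h, rfl⟩).trans (le_max_left _ _)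
    · rw [norm_inv]
      exact (inv_le_one_of_one_le₀ (not_le.1 h).le).trans (le_max_right _ _)
  rcases hB.hasEigenvalue_or_mem_resolventSet (μ := (-1 : ℂ)) (by norm_num) with h | h
  · obtain ⟨f, hf⟩ := h.exists_hasEigenvector
    have h1 : A (f : L1 ι) = -(f : L1 ι) := by
      have := congrArg Subtype.val hf.apply_eq_smul
      simpa [B] using this
    refine ⟨fun i => (μ i)⁻¹ * (f : L1 ι) i, hTsum _, ?_, fun i => ?_⟩
    · by_contra hcon
      push Not at hcon
      apply hf.2
      ext i
      have := hμinv f f.2 i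
      rw [hcon i, mul_zero] at this
      simpa using this.symm
    · rw [hμinv f f.2 i]
      have := hAi f i
      rwa [h1] at this
  · rw [spectrum.mem_resolventSet_iff, ContinuousLinearMap.isUnit_iff_bijective] at h
    have hc : col i0 ∈ Y := fun i => by
      change V (σ i) i0 = ζ * V i i0
      rw [← hVσ, hσ0]
    obtain ⟨f, hf⟩ := h.2 ⟨col i0, hc⟩
    have h1 : A (f : L1 ι) = -(f : L1 ι) - col i0 := by
      have := congrArg Subtype.val hf
      simp [B] at this
      rw [← this]; abel
    refine ⟨fun i => (if i = i0 then 1 else 0) + (μ i)⁻¹ * (f : L1 ι) i, ?_, ⟨i0, ?_⟩, fun i => ?_⟩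
    · refine Summable.of_nonneg_of_le (fun _ => norm_nonneg _) (fun i => norm_add_le _ _)
        (Summable.add ?_ (hTsum f))
      exact summable_of_ne_finset_zero (s := {i0}) (fun b hb => by
        simp only [Finset.mem_singleton] at hb; simp [hb])
    · simp [hY0 f f.2]
    · have h2 := hAi f i
      rw [h1] at h2
      have h3 : HasSum (fun j => V i j * (if j = i0 then 1 else 0)) (V i i0) := by
        convert hasSum_ite_eq i0 (V i i0) using 2 with j
        by_cases hj : j = i0 <;> simp [hj]
      have h4 := h3.add h2
      convert h4 using 1
      · ext j; ring
      · rw [mul_add, hμinv f f.2 i]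
        have : μ i * (if i = i0 then 1 else 0) = 0 := by
          by_cases hi : i = i0
          · simp [hi, (hi0 i0).2 rfl]
          · simp [hi]
        rw [this]
        change _ = V i i0 + (-(f : L1 ι) i - V i i0)
        ring


lemma schur_aux {ι : Type} (W : ι → ι → ℝ) (a : ι → ℝ) (C : ℝ) (hW : ∀ j i, 0 ≤ W j i)
    (ha : ∀ j, 0 ≤ a j) (hWs : ∀ j, Summable (W j)) (hWC : ∀ j, ∑' i, W j i ≤ C)
    (has : Summable a) :
    (∀ i, Summable fun j => W j i * a j) ∧ Summable fun i => ∑' j, W j i * a j := by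
  have hP : Summable fun x : ι × ι => W x.1 x.2 * a x.1 := by
    rw [summable_prod_of_nonneg (fun x => mul_nonneg (hW _ _) (ha _))]
    constructor
    · intro j
      exact (hWs j).mul_right (a j)
    · refine Summable.of_nonneg_of_le
        (fun j => tsum_nonneg fun i => mul_nonneg (hW _ _) (ha _))
        (fun j => ?_) (has.mul_left C)
      have : ∑' i, W j i * a j = (∑' i, W j i) * a j := tsum_mul_right
      rw [this]
      exact mul_le_mul_of_nonneg_right (hWC j) (ha j)
  have hP' : Summable fun x : ι × ι => W x.2 x.1 * a x.2 := hP.prod_symm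
  exact ⟨fun i => hP'.prod_factor i, hP'.prod⟩

lemma bootstrap {ι : Type} (μ : ι → ℂ) (V : ι → ι → ℂ) (g : ι → ℂ)
    (hg : Summable fun i => ‖g i‖) (heq : ∀ i, HasSum (fun j => V i j * g j) (-(μ i * g i)))
    (hV : ∀ k : ℕ, ∃ C : ℝ, ∀ j, (Summable fun i => (1 + ‖μ i - μ j‖) ^ k * ‖V i j‖) ∧
      ∑' i, (1 + ‖μ i - μ j‖) ^ k * ‖V i j‖ ≤ C) (k : ℕ) :
    Summable fun i => (1 + ‖μ i‖) ^ k * ‖g i‖ := by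
  induction k with
  | zero => simpa using hg
  | succ k ih =>
    obtain ⟨C, hC⟩ := hV k
    let W : ι → ι → ℝ := fun j i => (1 + ‖μ i - μ j‖) ^ k * ‖V i j‖
    have hW0 : ∀ j i, 0 ≤ W j i := fun j i => by positivity
    obtain ⟨h2', h1⟩ := schur_aux W (fun j => (1 + ‖μ j‖) ^ k * ‖g j‖) C hW0
      (fun j => by positivity) (fun j => (hC j).1) (fun j => (hC j).2) ih
    refine Summable.of_nonneg_of_le (fun _ => by positivity) (fun i => ?_) (ih.add h1)
    have h2 := h2' i
    have hb : ∀ j, ‖V i j * g j‖ * (1 + ‖μ i‖) ^ k ≤ W j i * ((1 + ‖μ j‖) ^ k * ‖g j‖) := by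
      intro j
      have h6 : (1 + ‖μ i‖) ≤ (1 + ‖μ i - μ j‖) * (1 + ‖μ j‖) := by
        have := norm_add_le (μ i - μ j) (μ j)
        rw [sub_add_cancel] at this
        nlinarith [norm_nonneg (μ i - μ j), norm_nonneg (μ j)]
      have h7 : (1 + ‖μ i‖) ^ k ≤ ((1 + ‖μ i - μ j‖) * (1 + ‖μ j‖)) ^ k :=
        pow_le_pow_left₀ (by positivity) h6 k
      calc ‖V i j * g j‖ * (1 + ‖μ i‖) ^ k
          ≤ ‖V i j * g j‖ * ((1 + ‖μ i - μ j‖) * (1 + ‖μ j‖)) ^ k :=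
            mul_le_mul_of_nonneg_left h7 (norm_nonneg _)
        _ = W j i * ((1 + ‖μ j‖) ^ k * ‖g j‖) := by
            simp only [W]; rw [mul_pow, norm_mul]; ring
    have h3 : (1 + ‖μ i‖) ^ k * (‖μ i‖ * ‖g i‖) ≤ ∑' j, W j i * ((1 + ‖μ j‖) ^ k * ‖g j‖) := by
      have hpos : 0 < (1 + ‖μ i‖) ^ k := by positivity
      have h5 : ‖∑' j, V i j * g j‖ ≤
          (∑' j, W j i * ((1 + ‖μ j‖) ^ k * ‖g j‖)) / (1 + ‖μ i‖) ^ k :=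
        tsum_of_norm_bounded (h2.hasSum.div_const _) fun j => by
          rw [le_div_iff₀ hpos]; exact hb j
      rw [(heq i).tsum_eq, norm_neg, norm_mul, le_div_iff₀ hpos] at h5
      rw [mul_comm]; exact h5
    calc (1 + ‖μ i‖) ^ (k + 1) * ‖g i‖
        = (1 + ‖μ i‖) ^ k * ‖g i‖ + (1 + ‖μ i‖) ^ k * (‖μ i‖ * ‖g i‖) := by ring
      _ ≤ _ := by gcongr


/-- plane wave -/
def pw (ν z : ℂ) : ℂ := Complex.exp (Complex.I * (pairing z ν : ℂ))

lemma pairing_eq (z w : ℂ) : pairing z w = z.re * w.re + z.im * w.im := by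
  simp [pairing]

lemma pw_norm (ν z : ℂ) : ‖pw ν z‖ = 1 := by
  rw [pw, mul_comm]; exact Complex.norm_exp_ofReal_mul_I _

lemma pw_add (ν ν' z : ℂ) : pw (ν + ν') z = pw ν z * pw ν' z := by
  simp only [pw, ← Complex.exp_add, pairing_eq]
  congr 1; push_cast [Complex.add_re, Complex.add_im]; ring

lemma pw_add_right (ν z w : ℂ) : pw ν (z + w) = pw ν z * pw ν w := by
  simp only [pw, ← Complex.exp_add, pairing_eq]
  congr 1; push_cast [Complex.add_re, Complex.add_im]; ring

lemma pw_neg (ν z : ℂ) : pw ν (-z) = pw (-ν) z := by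
  simp only [pw, pairing_eq]
  congr 1; push_cast [Complex.neg_re, Complex.neg_im]; ring

lemma pw_zero (z : ℂ) : pw 0 z = 1 := by simp [pw, pairing_eq]

def Rc : ℂ →L[ℝ] ℂ := Complex.ofRealCLM.comp Complex.reCLM
def Ic : ℂ →L[ℝ] ℂ := Complex.ofRealCLM.comp Complex.imCLM

lemma pw_hasFDerivAt (ν z : ℂ) : HasFDerivAt (pw ν)
    ((pw ν z * (Complex.I * ν.re)) • Rc + (pw ν z * (Complex.I * ν.im)) • Ic) z := by
  have h1 : HasFDerivAt (fun z : ℂ => Complex.I * (pairing z ν : ℂ))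
      ((Complex.I * ν.re) • Rc + (Complex.I * ν.im) • Ic) z := by
    have := ((Complex.I * ν.re) • Rc + (Complex.I * ν.im) • Ic).hasFDerivAt (x := z)
    convert! this using 1
    ext w
    simp [pairing_eq, Rc, Ic]; ring
  convert! h1.cexp using 1
  rw [smul_add, smul_smul, smul_smul]; rfl

def ser {κ : Type} (ν f : κ → ℂ) (z : ℂ) : ℂ := ∑' p, f p * pw (ν p) z

def Rapid {κ : Type} (ν f : κ → ℂ) : Prop := ∀ k : ℕ, Summable fun p => (1 + ‖ν p‖) ^ k * ‖f p‖

lemma Rapid.summable {κ : Type} {ν f : κ → ℂ} (h : Rapid ν f) : Summable fun p => ‖f p‖ := by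
  simpa using h 0

lemma ser_hasSum {κ : Type} {ν f : κ → ℂ} (h : Rapid ν f) (z : ℂ) :
    HasSum (fun p => f p * pw (ν p) z) (ser ν f z) := by
  refine (Summable.of_norm ?_).hasSum
  simpa [pw_norm] using h.summable

lemma Rapid.mul {κ : Type} {ν f : κ → ℂ} (h : Rapid ν f) (c : κ → ℂ) (hc : ∀ p, ‖c p‖ ≤ ‖ν p‖) :
    Rapid ν (fun p => f p * c p) := by
  intro k
  refine Summable.of_nonneg_of_le (fun _ => by positivity) (fun p => ?_) (h (k + 1))
  rw [norm_mul, pow_succ]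
  have : ‖c p‖ ≤ 1 + ‖ν p‖ := (hc p).trans (by linarith)
  calc (1 + ‖ν p‖) ^ k * (‖f p‖ * ‖c p‖) ≤ (1 + ‖ν p‖) ^ k * (‖f p‖ * (1 + ‖ν p‖)) := by gcongr
    _ = _ := by ring

lemma Rapid.re {κ : Type} {ν f : κ → ℂ} (h : Rapid ν f) :
    Rapid ν (fun p => f p * (Complex.I * (ν p).re)) :=
  h.mul _ fun p => by simpa using Complex.abs_re_le_norm (ν p)

lemma Rapid.im {κ : Type} {ν f : κ → ℂ} (h : Rapid ν f) :
    Rapid ν (fun p => f p * (Complex.I * (ν p).im)) :=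
  h.mul _ fun p => by simpa using Complex.abs_im_le_norm (ν p)

lemma ser_hasFDerivAt {κ : Type} {ν f : κ → ℂ} (h : Rapid ν f) (z : ℂ) :
    HasFDerivAt (ser ν f)
      (ser ν (fun p => f p * (Complex.I * (ν p).re)) z • Rc
        + ser ν (fun p => f p * (Complex.I * (ν p).im)) z • Ic) z := by
  have h1 := (ser_hasSum h.re z).smul_const Rc
  have h2 := (ser_hasSum h.im z).smul_const Ic
  have h3 := h1.add h2
  rw [← h3.tsum_eq]
  refine hasFDerivAt_tsum (𝕜 := ℝ)
    (u := fun p => ‖f p * (Complex.I * (ν p).re)‖ * ‖Rc‖ + ‖f p * (Complex.I * (ν p).im)‖ * ‖Ic‖)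
    (f := fun p z => f p * pw (ν p) z)
    (f' := fun p z => (f p * (Complex.I * (ν p).re) * pw (ν p) z) • Rc +
      (f p * (Complex.I * (ν p).im) * pw (ν p) z) • Ic)
    (x₀ := z) ((h.re.summable.mul_right _).add (h.im.summable.mul_right _))
    (fun p x => ?_) (fun p x => ?_) (ser_hasSum h z).summable z
  · convert! (pw_hasFDerivAt (ν p) x).const_mul (f p) using 1
    rw [smul_add, smul_smul, smul_smul]
    congr 2 <;> ring
  · refine (norm_add_le _ _).trans ?_
    rw [norm_smul, norm_smul, norm_mul _ (pw _ _), norm_mul _ (pw _ _), pw_norm, mul_one, mul_one]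

lemma ser_contDiff_nat {κ : Type} {ν : κ → ℂ} (n : ℕ) :
    ∀ {f : κ → ℂ}, Rapid ν f → ContDiff ℝ n (ser ν f) := by
  induction n with
  | zero =>
    intro f h
    rw [Nat.cast_zero, contDiff_zero]
    exact continuous_iff_continuousAt.2 fun z => (ser_hasFDerivAt h z).continuousAt
  | succ n ih =>
    intro f h
    rw [Nat.cast_add, Nat.cast_one, contDiff_succ_iff_fderiv]
    refine ⟨fun z => (ser_hasFDerivAt h z).differentiableAt, by simp, ?_⟩
    have : fderiv ℝ (ser ν f) = fun z => (ser ν (fun p => f p * (Complex.I * (ν p).re)) z • Rc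
        + ser ν (fun p => f p * (Complex.I * (ν p).im)) z • Ic) :=
      funext fun z => (ser_hasFDerivAt h z).fderiv
    rw [this]
    exact ((ih h.re).smul contDiff_const).add ((ih h.im).smul contDiff_const)

lemma ser_contDiff {κ : Type} {ν f : κ → ℂ} (h : Rapid ν f) :
    ContDiff ℝ (⊤ : ℕ∞) (ser ν f) := by
  rw [contDiff_infty]
  exact fun n => ser_contDiff_nat n h

lemma ser_twoDbar {κ : Type} {ν f : κ → ℂ} (h : Rapid ν f) (z : ℂ) :
    HasSum (fun p => ν p * f p * pw (ν p) z) (twoDbar (ser ν f) z) := by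
  have h1 := ser_hasSum h.re z
  have h2 := ser_hasSum h.im z
  have h3 := (h1.add (h2.mul_left Complex.I)).mul_left (-Complex.I)
  convert! h3 using 1
  · ext p
    have := Complex.re_add_im (ν p)
    linear_combination (-(f p * pw (ν p) z)) * this + (f p * pw (ν p) z) *
      ((ν p).re + (ν p).im * Complex.I) * Complex.I_mul_I
  · rw [twoDbar, (ser_hasFDerivAt h z).fderiv]
    simp [Rc, Ic]


open MeasureTheory

def ee (m : ℤ) (x : ℝ) : ℂ := Complex.exp (2 * Real.pi * Complex.I * m * x)

lemma ee_norm (m : ℤ) (x : ℝ) : ‖ee m x‖ = 1 := by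
  rw [ee, show 2 * (Real.pi : ℂ) * Complex.I * m * x = ((2 * Real.pi * m * x : ℝ) : ℂ) * Complex.I
    by push_cast; ring]
  exact Complex.norm_exp_ofReal_mul_I _

lemma ee_cont (m : ℤ) : Continuous (ee m) := by unfold ee; fun_prop

lemma ee_mul (m n : ℤ) (x : ℝ) : ee m x * ee n x = ee (m + n) x := by
  rw [ee, ee, ee, ← Complex.exp_add]; congr 1; push_cast; ring

lemma ee_int (m n : ℤ) : ee m (n : ℝ) = 1 := by
  rw [ee, Complex.exp_eq_one_iff]
  exact ⟨m * n, by push_cast; ring⟩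

lemma ee_hasDerivAt (m : ℤ) (x : ℝ) :
    HasDerivAt (ee m) (2 * Real.pi * Complex.I * m * ee m x) x := by
  have h1 : HasDerivAt (fun x : ℝ => 2 * Real.pi * Complex.I * m * (x : ℂ))
      (2 * Real.pi * Complex.I * m * 1) x :=
    (Complex.ofRealCLM.hasDerivAt (x := x)).const_mul _
  convert! h1.cexp using 1
  rw [ee]; ring

lemma ee_integral (k : ℤ) : ∫ x in (0 : ℝ)..1, ee k x = if k = 0 then 1 else 0 := by
  by_cases hk : k = 0
  · simp [hk, ee]
  · have hc : (2 * Real.pi * Complex.I * k : ℂ) ≠ 0 := by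
      simp [hk, Real.pi_ne_zero]
    have := integral_exp_mul_complex (a := 0) (b := 1) hc
    simp only [hk, if_false]
    unfold ee
    rw [this]
    have h1 := ee_int k 1
    have h0 := ee_int k 0
    unfold ee at h1 h0
    push_cast at h1 h0 ⊢
    rw [h1, h0]; simp

lemma ee_unique (a : ℤ → ℂ) (ha : Summable fun m => ‖a m‖)
    (h : ∀ x : ℝ, HasSum (fun m => a m * ee m x) 0) (k : ℤ) : a k = 0 := by
  have h1 := hasSum_integral_of_summable_integral_norm (μ := volume.restrict (Set.Ioc (0:ℝ) 1))
    (F := fun (m : ℤ) (x : ℝ) => a m * ee m x * ee (-k) x) (fun m => by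
      have : Continuous fun x : ℝ => a m * ee m x * ee (-k) x :=
        (continuous_const.mul (ee_cont m)).mul (ee_cont _)
      exact (this.intervalIntegrable 0 1).1) (by
      simpa [ee_norm] using ha)
  have h2 : ∀ x : ℝ, ∑' m, a m * ee m x * ee (-k) x = 0 := fun x => by
    have := ((h x).mul_right (ee (-k) x)).tsum_eq
    simpa using this
  simp only [h2, integral_zero] at h1
  have h3 : ∀ m, ∫ x in Set.Ioc (0:ℝ) 1, a m * ee m x * ee (-k) x = if m = k then a k else 0 := by
    intro m
    rw [← intervalIntegral.integral_of_le zero_le_one]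
    simp only [mul_assoc, ee_mul]
    rw [intervalIntegral.integral_const_mul, ee_integral]
    by_cases hm : m = k
    · simp [hm]
    · have : m + -k ≠ 0 := by omega
      simp [hm, this]
  simp only [h3] at h1
  exact (hasSum_ite_eq k (a k)).unique h1

lemma ee_unique2 (f : ℤ × ℤ → ℂ) (hf : Summable fun p => ‖f p‖)
    (h : ∀ s t : ℝ, HasSum (fun p => f p * (ee p.1 s * ee p.2 t)) 0) (p : ℤ × ℤ) : f p = 0 := by
  have hrow : ∀ m, Summable fun n => ‖f (m, n)‖ := fun m => hf.prod_factor m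
  have hrow' : ∀ m (t : ℝ), Summable fun n => f (m, n) * ee n t := fun m t =>
    Summable.of_norm (by simpa [ee_norm] using hrow m)
  have h1 : ∀ (t : ℝ) (m : ℤ), ∑' n, f (m, n) * ee n t = 0 := by
    intro t
    apply ee_unique
    · refine Summable.of_nonneg_of_le (fun _ => norm_nonneg _) (fun m => ?_) hf.prod
      exact tsum_of_norm_bounded (hrow m).hasSum fun n => by simp [ee_norm]
    · intro s
      have h2 := (h s t).prod_fiberwise (g := fun m => (∑' n, f (m, n) * ee n t) * ee m s)
        (fun m => by
          refine ((hrow' m t).hasSum.mul_right (ee m s)).congr_fun fun n => ?_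
          simp only; ring)
      exact h2
  exact ee_unique (fun n => f (p.1, n)) (hrow p.1) (fun t => by
    have := (hrow' p.1 t).hasSum
    rwa [h1] at this) p.2

/-- One dimensional Fourier inversion. -/
lemma fourier1 (h : ℝ → ℂ) (hc : Continuous h) (hp : ∀ x, h (x + 1) = h x)
    (hs : Summable fun n : ℤ => ∫ x in (0 : ℝ)..1, ee (-n) x * h x) (x : ℝ) :
    HasSum (fun n : ℤ => (∫ x in (0 : ℝ)..1, ee (-n) x * h x) * ee n x) (h x) := by
  have hper : Function.Periodic h 1 := hp
  let F : C(AddCircle (1 : ℝ), ℂ) := ⟨hper.lift, by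
    exact (QuotientAddGroup.isQuotientMap_mk (N := AddSubgroup.zmultiples (1 : ℝ))).continuous_iff.2
      (by exact hc)⟩
  have hF : ∀ x : ℝ, F (x : AddCircle (1 : ℝ)) = h x := fun x => hper.lift_coe x
  have hfe : ∀ (n : ℤ) (x : ℝ), (fourier n (x : AddCircle (1 : ℝ)) : ℂ) = ee n x := by
    intro n x; rw [fourier_coe_apply, ee]; congr 1; simp
  have hco : ∀ n : ℤ, fourierCoeff F n = ∫ x in (0 : ℝ)..1, ee (-n) x * h x := by
    intro n
    rw [fourierCoeff_eq_intervalIntegral F n 0]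
    simp only [hF, hfe, smul_eq_mul, zero_add]
    simp
  have := has_pointwise_sum_fourier_series_of_summable (f := F)
    (by simpa only [funext hco] using hs) (x : AddCircle (1 : ℝ))
  simpa only [hF, hfe, hco, smul_eq_mul] using this

lemma ibp (m : ℤ) (g g' : ℝ → ℂ) (hg : ∀ x, HasDerivAt g (g' x) x) (hg' : Continuous g')
    (h01 : g 1 = g 0) :
    ∫ x in (0 : ℝ)..1, ee (-m) x * (g x - g' x) =
      (1 - 2 * Real.pi * Complex.I * m) * ∫ x in (0 : ℝ)..1, ee (-m) x * g x := by
  have hgc : Continuous g := continuous_iff_continuousAt.2 fun x => (hg x).continuousAt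
  have h1 := intervalIntegral.integral_mul_deriv_eq_deriv_mul (a := 0) (b := 1)
    (u := ee (-m)) (v := g) (fun x _ => ee_hasDerivAt (-m) x) (fun x _ => hg x)
    ((continuous_const.mul (ee_cont _)).intervalIntegrable _ _) (hg'.intervalIntegrable _ _)
  have e1 := ee_int (-m) 1
  have e0 := ee_int (-m) 0
  push_cast at e1 e0
  rw [e1, e0, h01] at h1
  have h2 : ∫ x in (0 : ℝ)..1, 2 * Real.pi * Complex.I * ((-m : ℤ) : ℂ) * ee (-m) x * g x =
      (2 * Real.pi * Complex.I * ((-m : ℤ) : ℂ)) * ∫ x in (0 : ℝ)..1, ee (-m) x * g x := by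
    rw [← intervalIntegral.integral_const_mul]
    exact intervalIntegral.integral_congr fun x _ => by ring
  rw [h2] at h1
  simp only [mul_sub]
  have i1 : IntervalIntegrable (fun x => ee (-m) x * g x) volume 0 1 :=
    ((ee_cont _).mul hgc).intervalIntegrable _ _
  have i2 : IntervalIntegrable (fun x => ee (-m) x * g' x) volume 0 1 :=
    ((ee_cont _).mul hg').intervalIntegrable _ _
  rw [intervalIntegral.integral_sub i1 i2, h1]
  push_cast; ring

/-- smooth doubly periodic functions -/
def Good (Φ : ℝ × ℝ → ℂ) : Prop :=
  ContDiff ℝ (⊤ : ℕ∞) Φ ∧ (∀ x, Φ (x + (1, 0)) = Φ x) ∧ (∀ x, Φ (x + (0, 1)) = Φ x)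

def cf (Φ : ℝ × ℝ → ℂ) (m n : ℤ) : ℂ :=
  ∫ t in (0 : ℝ)..1, ee (-n) t * ∫ s in (0 : ℝ)..1, ee (-m) s * Φ (s, t)

lemma cf_swap (Φ : ℝ × ℝ → ℂ) (hΦ : Continuous Φ) (m n : ℤ) :
    cf Φ m n = ∫ s in (0 : ℝ)..1, ee (-m) s * ∫ t in (0 : ℝ)..1, ee (-n) t * Φ (s, t) := by
  unfold cf
  simp only [← intervalIntegral.integral_const_mul]
  have hc : Continuous (Function.uncurry fun t s : ℝ => ee (-n) t * (ee (-m) s * Φ (s, t))) := by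
    have h1 := ee_cont (-n)
    have h2 := ee_cont (-m)
    simp only [Function.uncurry_def]
    fun_prop
  rw [intervalIntegral_intervalIntegral_swap]
  · simp only [mul_left_comm]
  · have h1 : IntegrableOn (Function.uncurry fun t s : ℝ => ee (-n) t * (ee (-m) s * Φ (s, t)))
        (Set.Icc 0 1 ×ˢ Set.Icc 0 1) (volume.prod volume) :=
      hc.continuousOn.integrableOn_compact (isCompact_Icc.prod isCompact_Icc)
    have h2 := h1.mono_set (Set.prod_mono (Set.uIoc_subset_uIcc (a := (0:ℝ)) (b := 1))
      (Set.uIoc_subset_uIcc (a := (0:ℝ)) (b := 1)) |>.trans (by simp [Set.uIcc_of_le]))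
    exact h2

lemma Good.dir {Φ : ℝ × ℝ → ℂ} (h : Good Φ) (v : ℝ × ℝ) :
    Good (fun x => Φ x - fderiv ℝ Φ x v) := by
  have hp : ∀ w : ℝ × ℝ, (∀ x, Φ (x + w) = Φ x) → ∀ x, fderiv ℝ Φ (x + w) = fderiv ℝ Φ x := by
    intro w hw x
    rw [← fderiv_comp_add_right]
    congr 1; exact funext hw
  refine ⟨h.1.sub ((h.1.fderiv_right (m := (⊤ : ℕ∞)) (by simp)).clm_apply contDiff_const), ?_, ?_⟩
  · intro x; simp only [hp _ h.2.1, h.2.1]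
  · intro x; simp only [hp _ h.2.2, h.2.2]

lemma Good.cont {Φ : ℝ × ℝ → ℂ} (h : Good Φ) : Continuous Φ := h.1.continuous

lemma Good.diff {Φ : ℝ × ℝ → ℂ} (h : Good Φ) : Differentiable ℝ Φ :=
  h.1.differentiable (by simp)

lemma Good.dcont {Φ : ℝ × ℝ → ℂ} (h : Good Φ) (v : ℝ × ℝ) :
    Continuous fun x => fderiv ℝ Φ x v :=
  (h.1.continuous_fderiv (by simp)).clm_apply continuous_const

lemma cf_ds {Φ : ℝ × ℝ → ℂ} (h : Good Φ) (m n : ℤ) :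
    cf (fun x => Φ x - fderiv ℝ Φ x (1, 0)) m n = (1 - 2 * Real.pi * Complex.I * m) * cf Φ m n := by
  unfold cf
  rw [← intervalIntegral.integral_const_mul]
  refine intervalIntegral.integral_congr fun t _ => ?_
  simp only
  rw [ibp m (fun s => Φ (s, t)) (fun s => fderiv ℝ Φ (s, t) (1, 0))]
  · ring
  · intro s
    have h1 : HasDerivAt (fun s : ℝ => (s, t)) ((1 : ℝ), (0 : ℝ)) s :=
      (hasDerivAt_id s).prodMk (hasDerivAt_const s t)
    exact (h.diff (s, t)).hasFDerivAt.comp_hasDerivAt s h1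
  · exact (h.dcont (1, 0)).comp (by fun_prop)
  · have := h.2.1 (0, t)
    simpa using this

lemma cf_dt {Φ : ℝ × ℝ → ℂ} (h : Good Φ) (m n : ℤ) :
    cf (fun x => Φ x - fderiv ℝ Φ x (0, 1)) m n = (1 - 2 * Real.pi * Complex.I * n) * cf Φ m n := by
  rw [cf_swap _ h.cont, cf_swap _ (h.dir (0, 1)).cont]
  rw [← intervalIntegral.integral_const_mul]
  refine intervalIntegral.integral_congr fun s _ => ?_
  rw [ibp n (fun t => Φ (s, t)) (fun t => fderiv ℝ Φ (s, t) (0, 1))]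
  · ring
  · intro t
    have h1 : HasDerivAt (fun t : ℝ => (s, t)) ((0 : ℝ), (1 : ℝ)) t :=
      (hasDerivAt_const t s).prodMk (hasDerivAt_id t)
    exact (h.diff (s, t)).hasFDerivAt.comp_hasDerivAt t h1
  · exact (h.dcont (0, 1)).comp (by fun_prop)
  · have := h.2.2 (s, 0)
    simpa using this

lemma cf_bound {Φ : ℝ × ℝ → ℂ} (h : Good Φ) : ∃ C, ∀ m n, ‖cf Φ m n‖ ≤ C := by
  obtain ⟨C, hC⟩ := (isCompact_Icc.prod isCompact_Icc : IsCompact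
    (Set.Icc (0:ℝ) 1 ×ˢ Set.Icc (0:ℝ) 1)).exists_bound_of_continuousOn h.cont.continuousOn
  refine ⟨C, fun m n => ?_⟩
  have h1 : ∀ t ∈ Set.uIoc (0:ℝ) 1,
      ‖ee (-n) t * ∫ s in (0 : ℝ)..1, ee (-m) s * Φ (s, t)‖ ≤ C := by
    intro t ht
    rw [Set.uIoc_of_le zero_le_one] at ht
    rw [norm_mul, ee_norm, one_mul]
    have := intervalIntegral.norm_integral_le_of_norm_le_const (a := (0:ℝ)) (b := 1)
      (f := fun s => ee (-m) s * Φ (s, t)) (C := C) (fun s hs => by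
        rw [Set.uIoc_of_le zero_le_one] at hs
        rw [norm_mul, ee_norm, one_mul]
        exact hC _ ⟨⟨hs.1.le, hs.2⟩, ⟨ht.1.le, ht.2⟩⟩)
    simpa using this
  have := intervalIntegral.norm_integral_le_of_norm_le_const h1
  simpa [cf] using this

lemma cf_decay (a b : ℕ) : ∀ {Φ : ℝ × ℝ → ℂ}, Good Φ → ∃ C, ∀ m n : ℤ,
    ‖1 - 2 * Real.pi * Complex.I * m‖ ^ a * ‖1 - 2 * Real.pi * Complex.I * n‖ ^ b *
      ‖cf Φ m n‖ ≤ C := by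
  induction a with
  | zero =>
    induction b with
    | zero => intro Φ h; simpa using cf_bound h
    | succ b ih =>
      intro Φ h
      obtain ⟨C, hC⟩ := ih (h.dir (0, 1))
      refine ⟨C, fun m n => ?_⟩
      have := hC m n
      rw [cf_dt h, norm_mul] at this
      convert! this using 1; ring
  | succ a ih =>
    intro Φ h
    obtain ⟨C, hC⟩ := ih (h.dir (1, 0))
    refine ⟨C, fun m n => ?_⟩
    have := hC m n
    rw [cf_ds h, norm_mul] at this
    convert! this using 1; ring

lemma one_add_le (m : ℤ) : 1 + |(m : ℝ)| ≤ 2 * ‖(1 - 2 * Real.pi * Complex.I * m : ℂ)‖ := by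
  have h1 := Complex.abs_re_le_norm (1 - 2 * Real.pi * Complex.I * m : ℂ)
  have h2 := Complex.abs_im_le_norm (1 - 2 * Real.pi * Complex.I * m : ℂ)
  simp at h1 h2
  rw [abs_of_pos Real.pi_pos] at h2
  have := Real.pi_gt_three
  nlinarith [abs_nonneg (m : ℝ)]

lemma summable_sq : Summable fun m : ℤ => (1 + |(m : ℝ)|)⁻¹ ^ 2 := by
  have h := (Real.summable_one_div_int_pow (p := 2)).2 one_lt_two
  have h2 : Summable fun m : ℤ => if m = 0 then (1 : ℝ) else 0 :=
    (hasSum_ite_eq 0 (1 : ℝ)).summable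
  refine Summable.of_nonneg_of_le (fun _ => by positivity) (fun m => ?_) (h.add h2)
  by_cases hm : m = 0
  · simp [hm]
  · simp only [hm, if_false, add_zero, one_div, inv_pow]
    have : (0:ℝ) < (m:ℝ)^2 := by positivity
    apply inv_anti₀ this
    nlinarith [sq_abs (m:ℝ), abs_nonneg (m:ℝ)]

lemma cf_rapid {Φ : ℝ × ℝ → ℂ} (h : Good Φ) (k : ℕ) : Summable fun p : ℤ × ℤ =>
    ((1 + |(p.1 : ℝ)|) * (1 + |(p.2 : ℝ)|)) ^ k * ‖cf Φ p.1 p.2‖ := by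
  obtain ⟨C, hC⟩ := cf_decay (k + 2) (k + 2) h
  have hs := (summable_sq.mul_of_nonneg summable_sq (fun _ => by positivity)
    (fun _ => by positivity)).mul_left (4 ^ (k + 2) * C)
  refine Summable.of_nonneg_of_le (fun _ => by positivity) (fun p => ?_) hs
  obtain ⟨m, n⟩ := p
  simp only
  have hm := one_add_le m
  have hn := one_add_le n
  have h0 := hC m n
  set x := 1 + |(m : ℝ)|
  set y := 1 + |(n : ℝ)|
  have hx : 0 < x := by positivity
  have hy : 0 < y := by positivity
  have h1 : (x * y) ^ (k + 2) * ‖cf Φ m n‖ ≤ 4 ^ (k + 2) * C := by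
    calc (x * y) ^ (k + 2) * ‖cf Φ m n‖
        ≤ ((2 * ‖(1 - 2 * Real.pi * Complex.I * m : ℂ)‖) *
          (2 * ‖(1 - 2 * Real.pi * Complex.I * n : ℂ)‖)) ^ (k + 2) * ‖cf Φ m n‖ := by
          gcongr
      _ = 4 ^ (k + 2) * (‖(1 - 2 * Real.pi * Complex.I * m : ℂ)‖ ^ (k + 2) *
          ‖(1 - 2 * Real.pi * Complex.I * n : ℂ)‖ ^ (k + 2) * ‖cf Φ m n‖) := by
          rw [show ∀ a b : ℝ, (2*a)*(2*b) = 4*(a*b) from fun a b => by ring, mul_pow, mul_pow]; ring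
      _ ≤ _ := by gcongr
  calc (x * y) ^ k * ‖cf Φ m n‖ = ((x * y) ^ (k + 2) * ‖cf Φ m n‖) * (x⁻¹ ^ 2 * y⁻¹ ^ 2) := by
        field_simp
        ring
    _ ≤ _ := by gcongr

lemma fourier2 {Φ : ℝ × ℝ → ℂ} (h : Good Φ) (s t : ℝ) :
    HasSum (fun p : ℤ × ℤ => cf Φ p.1 p.2 * (ee p.1 s * ee p.2 t)) (Φ (s, t)) := by
  have hsum : Summable fun p : ℤ × ℤ => ‖cf Φ p.1 p.2‖ := by simpa using cf_rapid h 0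
  have hrow : ∀ m, Summable fun n => ‖cf Φ m n‖ := fun m => hsum.prod_factor m
  have hc := h.cont
  -- inner
  have h1 : ∀ (m : ℤ) (t : ℝ), HasSum (fun n => cf Φ m n * ee n t)
      (∫ s in (0 : ℝ)..1, ee (-m) s * Φ (s, t)) := by
    intro m t
    refine fourier1 (fun t => ∫ s in (0 : ℝ)..1, ee (-m) s * Φ (s, t)) ?_ ?_ ?_ t
    · apply intervalIntegral.continuous_parametric_intervalIntegral_of_continuous'
      have := ee_cont (-m)
      simp only [Function.uncurry_def]
      fun_prop
    · intro t
      refine intervalIntegral.integral_congr fun s _ => ?_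
      have := h.2.2 (s, t)
      simp only [Prod.mk_add_mk, add_zero] at this
      simp only [this]
    · exact (hrow m).of_norm
  have h2 : HasSum (fun m => (∫ s in (0 : ℝ)..1, ee (-m) s * Φ (s, t)) * ee m s) (Φ (s, t)) := by
    refine fourier1 (fun s => Φ (s, t)) (by fun_prop) ?_ ?_ s
    · intro s
      have := h.2.1 (s, t)
      simpa using this
    · refine Summable.of_norm_bounded hsum.prod fun m => ?_
      rw [← (h1 m t).tsum_eq]
      exact tsum_of_norm_bounded (hrow m).hasSum fun n => by simp [ee_norm]
  have hS : Summable fun p : ℤ × ℤ => cf Φ p.1 p.2 * (ee p.1 s * ee p.2 t) :=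
    Summable.of_norm (by simpa [ee_norm] using hsum)
  have h3 := hS.hasSum.prod_fiberwise
    (g := fun m => (∫ s in (0 : ℝ)..1, ee (-m) s * Φ (s, t)) * ee m s) (fun m => by
      refine ((h1 m t).mul_right (ee m s)).congr_fun fun n => ?_
      simp only; ring)
  rw [h2.unique h3]; exact hS.hasSum


lemma omega_re : ω.re = -(1 / 2) := by
  rw [ω, show 2 * (Real.pi : ℂ) * Complex.I / 3 = ((Real.pi - Real.pi / 3 : ℝ) : ℂ) * Complex.I by
    push_cast; ring, Complex.exp_ofReal_mul_I_re, Real.cos_pi_sub, Real.cos_pi_div_three]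

lemma omega_im : ω.im = √3 / 2 := by
  rw [ω, show 2 * (Real.pi : ℂ) * Complex.I / 3 = ((Real.pi - Real.pi / 3 : ℝ) : ℂ) * Complex.I by
    push_cast; ring, Complex.exp_ofReal_mul_I_im, Real.sin_pi_sub, Real.sin_pi_div_three]

lemma omega_cube : ω ^ 3 = 1 := by
  rw [ω, ← Complex.exp_nat_mul, Complex.exp_eq_one_iff]
  exact ⟨1, by push_cast; ring⟩

lemma omega_ne_zero : ω ≠ 0 := Complex.exp_ne_zero _

lemma omega_ne_one : ω ≠ 1 := by
  intro h
  have := congrArg Complex.re h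
  rw [omega_re] at this
  norm_num at this

lemma omega_norm : ‖ω‖ = 1 := by
  have h : ‖ω‖ ^ 3 = 1 := by rw [← norm_pow, omega_cube, norm_one]
  exact (pow_eq_one_iff_of_nonneg (norm_nonneg _) (by norm_num)).1 h

lemma sqrt3_sq : √3 * √3 = 3 := Real.mul_self_sqrt (by norm_num)

lemma K_re : Kpt.re = 4 * Real.pi / 3 := by
  rw [Kpt, show 4 * (Real.pi : ℂ) / 3 = ((4 * Real.pi / 3 : ℝ) : ℂ) by push_cast; ring,
    Complex.ofReal_re]

lemma K_im : Kpt.im = 0 := by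
  rw [Kpt, show 4 * (Real.pi : ℂ) / 3 = ((4 * Real.pi / 3 : ℝ) : ℂ) by push_cast; ring,
    Complex.ofReal_im]

/-- dual lattice parametrization -/
def lam (p : ℤ × ℤ) : ℂ :=
  ⟨2 * Real.pi * p.1, 2 * Real.pi * √3 / 3 * (p.1 + 2 * p.2)⟩

lemma lam_add (p q : ℤ × ℤ) : lam (p + q) = lam p + lam q := by
  apply Complex.ext <;> simp [lam] <;> ring

lemma lam_sub (p q : ℤ × ℤ) : lam (p - q) = lam p - lam q := by
  apply Complex.ext <;> simp [lam] <;> ring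

/-- rotation of the shifted dual lattice -/
def rho : ℤ × ℤ ≃ ℤ × ℤ where
  toFun p := (-p.1 - p.2 - 1, p.1 + 1)
  invFun p := (p.2 - 1, -p.1 - p.2)
  left_inv p := by ext <;> simp <;> ring
  right_inv p := by ext <;> simp <;> ring

/-- rotation of the dual lattice -/
def tau : ℤ × ℤ ≃ ℤ × ℤ where
  toFun p := (-p.1 - p.2, p.1)
  invFun p := (p.2, -p.1 - p.2)
  left_inv p := by ext <;> simp <;> ring
  right_inv p := by ext <;> simp <;> ring

lemma rho_cube (p : ℤ × ℤ) : rho (rho (rho p)) = p := by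
  ext <;> simp [rho] <;> ring

lemma rho_sub_tau (p q : ℤ × ℤ) : rho p - tau q = rho (p - q) := by
  ext <;> simp [rho, tau] <;> ring

lemma lam_tau (p : ℤ × ℤ) : lam (tau p) = ω * lam p := by
  have h3 := sqrt3_sq
  apply Complex.ext
  · simp only [lam, tau, Equiv.coe_fn_mk, Complex.mul_re, omega_re, omega_im]
    push_cast
    linear_combination (Real.pi / 3 * (p.1 + 2 * p.2)) * h3
  · simp only [lam, tau, Equiv.coe_fn_mk, Complex.mul_im, omega_re, omega_im]
    push_cast
    ring

lemma lam_rho (p : ℤ × ℤ) : lam (rho p) + Kpt = ω * (lam p + Kpt) := by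
  have h3 := sqrt3_sq
  apply Complex.ext
  · simp only [lam, rho, Equiv.coe_fn_mk, Complex.mul_re, Complex.add_re, Complex.add_im, omega_re,
      omega_im, K_re, K_im]
    push_cast
    linear_combination (Real.pi / 3 * (p.1 + 2 * p.2)) * h3
  · simp only [lam, rho, Equiv.coe_fn_mk, Complex.mul_im, Complex.add_re, Complex.add_im, omega_re,
      omega_im, K_re, K_im]
    push_cast
    ring

lemma pairing_lam (s t : ℝ) (p : ℤ × ℤ) :
    pairing ((s : ℂ) + t * ω) (lam p) = 2 * Real.pi * (p.1 * s + p.2 * t) := by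
  have h3 := sqrt3_sq
  rw [pairing_eq]
  simp only [lam, Complex.add_re, Complex.add_im, Complex.mul_re, Complex.mul_im, omega_re,
    omega_im, Complex.ofReal_re, Complex.ofReal_im]
  linear_combination (Real.pi / 3 * t * (p.1 + 2 * p.2)) * h3

lemma pw_lam (s t : ℝ) (p : ℤ × ℤ) :
    pw (lam p) ((s : ℂ) + t * ω) = ee p.1 s * ee p.2 t := by
  rw [pw, pairing_lam, ee, ee, ← Complex.exp_add]
  congr 1; push_cast; ring

lemma pw_lam_Lam {γ : ℂ} (hγ : γ ∈ Lam) (p : ℤ × ℤ) : pw (lam p) γ = 1 := by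
  obtain ⟨m, n, rfl⟩ := hγ
  have := pw_lam m n p
  push_cast at this
  rw [this, ee_int, ee_int, one_mul]

lemma pw_K_cube {γ : ℂ} (hγ : γ ∈ Lam) : pw Kpt γ * pw Kpt γ * pw Kpt γ = 1 := by
  obtain ⟨m, n, rfl⟩ := hγ
  rw [pw, pairing_eq, K_re, K_im, ← Complex.exp_add, ← Complex.exp_add, Complex.exp_eq_one_iff]
  refine ⟨2 * m - n, ?_⟩
  simp [omega_re]
  ring

lemma pw_rot (ν z : ℂ) : pw (ω * ν) (ω * z) = pw ν z := by
  have h3 := sqrt3_sq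
  rw [pw, pw]
  congr 3
  rw [pairing_eq, pairing_eq]
  simp only [Complex.mul_re, Complex.mul_im, omega_re, omega_im]
  linear_combination ((z.re * ν.re + z.im * ν.im) / 4) * h3

lemma exists_coord (z : ℂ) : ∃ s t : ℝ, z = (s : ℂ) + t * ω := by
  have h3 := sqrt3_sq
  refine ⟨z.re + z.im * √3 / 3, z.im * 2 * √3 / 3, ?_⟩
  apply Complex.ext
  · simp only [Complex.add_re, Complex.mul_re, omega_re, omega_im, Complex.ofReal_re,
      Complex.ofReal_im]
    ring
  · simp only [Complex.add_im, Complex.mul_im, omega_re, omega_im, Complex.ofReal_re,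
      Complex.ofReal_im]
    linear_combination (-z.im / 3) * h3

lemma sqrt3_bounds : 1.5 ≤ √3 ∧ √3 ≤ 2 := by
  constructor
  · rw [Real.le_sqrt (by norm_num) (by norm_num)]; norm_num
  · rw [Real.sqrt_le_left (by norm_num)]; norm_num

lemma lam_lower (p : ℤ × ℤ) : |(p.1 : ℝ)| ≤ ‖lam p‖ ∧ |(p.2 : ℝ)| ≤ ‖lam p‖ := by
  have h1 := Complex.abs_re_le_norm (lam p)
  have h2 := Complex.abs_im_le_norm (lam p)
  obtain ⟨h3, h4⟩ := sqrt3_bounds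
  have hpi := Real.pi_gt_three
  simp only [lam, abs_mul] at h1 h2
  rw [abs_of_pos (show (0 : ℝ) < 2 * Real.pi * √3 / 3 by positivity)] at h2
  rw [abs_of_pos Real.pi_pos, abs_of_pos (show (0 : ℝ) < 2 by norm_num)] at h1
  have hc : 1 ≤ 2 * Real.pi * √3 / 3 := by nlinarith
  have e1 : |(p.1 : ℝ)| ≤ ‖lam p‖ := by
    refine le_trans ?_ h1
    nlinarith [abs_nonneg (p.1 : ℝ)]
  have e2 : |(p.1 : ℝ) + 2 * p.2| ≤ ‖lam p‖ := by
    refine le_trans ?_ h2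
    nlinarith [abs_nonneg ((p.1 : ℝ) + 2 * p.2)]
  refine ⟨e1, ?_⟩
  rw [abs_le] at *
  constructor <;> linarith [e1.1, e1.2, e2.1, e2.2]

lemma lam_finite (w : ℂ) (R : ℝ) : {p | ‖lam p + w‖ ≤ R}.Finite := by
  obtain ⟨N, hN⟩ := exists_nat_ge (R + ‖w‖)
  refine ((Set.finite_Icc (-(N : ℤ)) N).prod (Set.finite_Icc (-(N : ℤ)) N)).subset ?_
  intro p hp
  have hp' : ‖lam p + w‖ ≤ R := hp
  have h0 : ‖lam p‖ ≤ N := by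
    have : ‖lam p‖ ≤ ‖lam p + w‖ + ‖w‖ := by simpa using norm_sub_le (lam p + w) w
    linarith
  obtain ⟨h1, h2⟩ := lam_lower p
  have h1' := abs_le.1 (h1.trans h0)
  have h2' := abs_le.1 (h2.trans h0)
  refine ⟨⟨?_, ?_⟩, ⟨?_, ?_⟩⟩
  · exact_mod_cast h1'.1
  · exact_mod_cast h1'.2
  · exact_mod_cast h2'.1
  · exact_mod_cast h2'.2

lemma lam_upper (p : ℤ × ℤ) :
    1 + ‖lam p‖ ≤ 100 * ((1 + |(p.1 : ℝ)|) * (1 + |(p.2 : ℝ)|)) := by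
  have h := Complex.norm_le_abs_re_add_abs_im (lam p)
  obtain ⟨h3, h4⟩ := sqrt3_bounds
  have hpi := Real.pi_lt_four
  have hpi0 := Real.pi_pos
  simp only [lam, abs_mul] at h
  rw [abs_of_pos (show (0 : ℝ) < 2 * Real.pi * √3 / 3 by positivity), abs_of_pos Real.pi_pos,
    abs_of_pos (show (0 : ℝ) < 2 by norm_num)] at h
  have h5 : |(p.1 : ℝ) + 2 * p.2| ≤ |(p.1 : ℝ)| + 2 * |(p.2 : ℝ)| := by
    refine (abs_add_le _ _).trans ?_
    rw [abs_mul]; simp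
  have hc : 2 * Real.pi * √3 / 3 ≤ 8 := by nlinarith
  have a1 := abs_nonneg (p.1 : ℝ)
  have a2 := abs_nonneg (p.2 : ℝ)
  have h6 : 2 * Real.pi * √3 / 3 * |(p.1 : ℝ) + 2 * p.2| ≤ 8 * (|(p.1 : ℝ)| + 2 * |(p.2 : ℝ)|) :=
    mul_le_mul hc h5 (abs_nonneg _) (by norm_num)
  have h7 : 2 * Real.pi * |(p.1 : ℝ)| ≤ 8 * |(p.1 : ℝ)| := by nlinarith
  have h8 : ‖lam p‖ ≤ 8 * |(p.1 : ℝ)| + 8 * (|(p.1 : ℝ)| + 2 * |(p.2 : ℝ)|) := by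
    refine h.trans ?_
    linarith
  nlinarith [mul_nonneg a1 a2]

lemma Rapid.shift {κ : Type} {ν f : κ → ℂ} (h : Rapid ν f) (w : ℂ) :
    Rapid (fun p => ν p + w) f := by
  intro k
  refine Summable.of_nonneg_of_le (fun _ => by positivity) (fun p => ?_)
    ((h k).mul_left ((1 + ‖w‖) ^ k))
  rw [← mul_assoc, ← mul_pow]
  have : 1 + ‖ν p + w‖ ≤ (1 + ‖w‖) * (1 + ‖ν p‖) := by
    have := norm_add_le (ν p) w
    nlinarith [mul_nonneg (norm_nonneg w) (norm_nonneg (ν p))]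
  gcongr

lemma cf_Rapid {Φ : ℝ × ℝ → ℂ} (h : Good Φ) : Rapid lam (fun p => cf Φ p.1 p.2) := by
  intro k
  refine Summable.of_nonneg_of_le (fun _ => by positivity) (fun p => ?_)
    ((cf_rapid h k).mul_left (100 ^ k))
  rw [← mul_assoc, ← mul_pow]
  have := lam_upper p
  gcongr

lemma pw_contDiff (ν : ℂ) : ContDiff ℝ (⊤ : ℕ∞) (pw ν) := by
  have h : pw ν = fun z => Complex.exp (((Complex.I * ν.re) • Rc + (Complex.I * ν.im) • Ic) z) := by
    ext w
    simp [pw, pairing_eq, Rc, Ic]; ring_nf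
  rw [h]
  exact (ContinuousLinearMap.contDiff _).cexp

/-- Fourier expansion of the potential. -/
lemma potential_fourier {U : ℂ → ℂ} (hU : IsPotential U) :
    ∃ c : ℤ × ℤ → ℂ, Rapid (fun p => lam p + Kpt) c ∧
      ∀ z, HasSum (fun p => c p * pw (lam p + Kpt) z) (U z) := by
  let G : ℂ → ℂ := fun z => pw (-Kpt) z * U z
  have hG : ∀ γ ∈ Lam, ∀ z, G (z + γ) = G z := by
    intro γ hγ z
    simp only [G]
    rw [hU.2.1 γ hγ z, pw_add_right]
    have h1 : pw (-Kpt) γ * Complex.exp (-2 * Complex.I * (pairing γ Kpt : ℂ)) = 1 := by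
      have h2 : (pw Kpt γ * pw Kpt γ * pw Kpt γ) *
          (pw (-Kpt) γ * Complex.exp (-2 * Complex.I * (pairing γ Kpt : ℂ))) = 1 := by
        rw [← pw_neg]
        simp only [pw, ← Complex.exp_add]
        rw [Complex.exp_eq_one_iff]
        refine ⟨0, ?_⟩
        have : pairing (-γ) Kpt = - pairing γ Kpt := by simp [pairing]
        rw [this]; push_cast; ring
      rwa [pw_K_cube hγ, one_mul] at h2
    linear_combination (pw (-Kpt) z * U z) * h1
  let Φ : ℝ × ℝ → ℂ := fun x => G ((x.1 : ℂ) + x.2 * ω)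
  have hΦ : Good Φ := by
    refine ⟨?_, ?_, ?_⟩
    · have hGs : ContDiff ℝ (⊤ : ℕ∞) G := (pw_contDiff _).mul hU.1
      refine hGs.comp ?_
      have e1 : ContDiff ℝ (⊤ : ℕ∞) fun x : ℝ × ℝ => (x.1 : ℂ) :=
        Complex.ofRealCLM.contDiff.comp contDiff_fst
      have e2 : ContDiff ℝ (⊤ : ℕ∞) fun x : ℝ × ℝ => (x.2 : ℂ) :=
        Complex.ofRealCLM.contDiff.comp contDiff_snd
      exact e1.add (e2.mul contDiff_const)
    · intro x
      have := hG 1 ⟨1, 0, by simp⟩ ((x.1 : ℂ) + x.2 * ω)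
      simp only [Φ]
      rw [← this]
      congr 1; simp; ring
    · intro x
      have := hG ω ⟨0, 1, by simp⟩ ((x.1 : ℂ) + x.2 * ω)
      simp only [Φ]
      rw [← this]
      congr 1; simp; ring
  refine ⟨fun p => cf Φ p.1 p.2, (cf_Rapid hΦ).shift Kpt, fun z => ?_⟩
  obtain ⟨s, t, rfl⟩ := exists_coord z
  have h := (fourier2 hΦ s t).mul_right (pw Kpt ((s : ℂ) + t * ω))
  have e : Φ (s, t) * pw Kpt ((s : ℂ) + t * ω) = U ((s : ℂ) + t * ω) := by
    have : pw (-Kpt) ((s : ℂ) + t * ω) * pw Kpt ((s : ℂ) + t * ω) = 1 := by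
      rw [← pw_add, neg_add_cancel, pw_zero]
    simp only [Φ, G]
    linear_combination U ((s : ℂ) + t * ω) * this
  rw [e] at h
  refine h.congr_fun fun p => ?_
  rw [pw_add, pw_lam]; ring

lemma sym_step {U : ℂ → ℂ} (hU : IsPotential U) (c : ℤ × ℤ → ℂ)
    (hc : Rapid (fun p => lam p + Kpt) c)
    (hs : ∀ z, HasSum (fun p => c p * pw (lam p + Kpt) z) (U z)) :
    Rapid (fun p => lam p + Kpt) (fun p => ω ^ 2 * c (rho p)) ∧
    ∀ z, HasSum (fun p => ω ^ 2 * c (rho p) * pw (lam p + Kpt) z) (U z) := by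
  constructor
  · intro k
    refine ((hc k).comp_injective rho.injective).congr fun p => ?_
    simp only [Function.comp, lam_rho, norm_mul, norm_pow, omega_norm, one_mul, one_pow]
  · intro z
    have h := (rho.hasSum_iff.2 (hs (ω * z))).mul_left (ω ^ 2)
    rw [hU.2.2.1, ← mul_assoc, ← pow_succ, omega_cube, one_mul] at h
    refine h.congr_fun fun p => ?_
    simp only [Function.comp, lam_rho, pw_rot]
    ring

lemma Rapid.add {κ : Type} {ν f g : κ → ℂ} (hf : Rapid ν f) (hg : Rapid ν g) :
    Rapid ν (fun p => f p + g p) := by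
  intro k
  refine Summable.of_nonneg_of_le (fun _ => by positivity) (fun p => ?_) ((hf k).add (hg k))
  rw [← mul_add]
  gcongr
  exact norm_add_le _ _

lemma Rapid.const_mul {κ : Type} {ν f : κ → ℂ} (hf : Rapid ν f) (a : ℂ) :
    Rapid ν (fun p => a * f p) := by
  intro k
  refine ((hf k).mul_left ‖a‖).congr fun p => ?_
  rw [norm_mul]; ring

lemma potential_sym {U : ℂ → ℂ} (hU : IsPotential U) :
    ∃ c : ℤ × ℤ → ℂ, Rapid (fun p => lam p + Kpt) c ∧ (∀ p, c (rho p) = ω * c p) ∧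
      ∀ z, HasSum (fun p => c p * pw (lam p + Kpt) z) (U z) := by
  obtain ⟨c, h1, h2⟩ := potential_fourier hU
  obtain ⟨h3, h4⟩ := sym_step hU c h1 h2
  obtain ⟨h5, h6⟩ := sym_step hU _ h3 h4
  refine ⟨_, ((h1.add h3).add h5).const_mul (1 / 3), fun p => ?_, fun z => ?_⟩
  · simp only [rho_cube]
    linear_combination (1 / 3) * (ω * c p - c (rho p) - ω ^ 2 * c (rho (rho p))) * omega_cube
  · have := (((h2 z).add (h4 z)).add (h6 z)).mul_left (1 / 3)
    rw [show (1 / 3 : ℂ) * (U z + U z + U z) = U z by ring] at this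
    refine this.congr_fun fun p => ?_
    ring


lemma conv_sum {κ : Type} (x y F : κ → ℂ) (X Y : ℂ) (hx : Summable fun p => ‖x p‖)
    (hy : Summable fun p => ‖y p‖) (hX : HasSum x X) (hY : HasSum y Y) (d : κ × κ ≃ κ × κ)
    (h : ∀ p, HasSum (fun r => x (d (p, r)).1 * y (d (p, r)).2) (F p)) : HasSum F (X * Y) := by
  have h1 : HasSum (fun q : κ × κ => x q.1 * y q.2) (X * Y) :=
    hX.mul hY (summable_mul_of_summable_norm hx hy)
  have h2 := d.hasSum_iff.2 h1
  exact h2.prod_fiberwise h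

/-- (p, r) to (p - r, r) -/
def shear1 : (ℤ × ℤ) × (ℤ × ℤ) ≃ (ℤ × ℤ) × (ℤ × ℤ) where
  toFun q := (q.1 - q.2, q.2)
  invFun q := (q.1 + q.2, q.2)
  left_inv q := by simp
  right_inv q := by simp

/-- (p, r) to (r - p, r) -/
def shear2 : (ℤ × ℤ) × (ℤ × ℤ) ≃ (ℤ × ℤ) × (ℤ × ℤ) where
  toFun q := (q.2 - q.1, q.2)
  invFun q := (q.2 - q.1, q.2)
  left_inv q := by simp
  right_inv q := by simp

abbrev Idx := (ℤ × ℤ) ⊕ (ℤ × ℤ)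

def mu : Idx → ℂ
  | Sum.inl p => lam p + Kpt
  | Sum.inr p => lam p

def sig : Idx ≃ Idx := Equiv.sumCongr rho tau

def VV (α : ℂ) (c : ℤ × ℤ → ℂ) : Idx → Idx → ℂ
  | Sum.inl p, Sum.inr r => α * c (p - r)
  | Sum.inr p, Sum.inl r => α * c (r - p)
  | Sum.inl _, Sum.inl _ => 0
  | Sum.inr _, Sum.inr _ => 0

lemma hasSum_inl {f : Idx → ℂ} (h : ∀ p, f (Sum.inr p) = 0) (a : ℂ) :
    HasSum (fun p => f (Sum.inl p)) a ↔ HasSum f a := by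
  refine Sum.inl_injective.hasSum_iff (f := f) fun x hx => ?_
  rcases x with p | p
  · exact absurd ⟨p, rfl⟩ hx
  · exact h p

lemma hasSum_inr {f : Idx → ℂ} (h : ∀ p, f (Sum.inl p) = 0) (a : ℂ) :
    HasSum (fun p => f (Sum.inr p)) a ↔ HasSum f a := by
  refine Sum.inr_injective.hasSum_iff (f := f) fun x hx => ?_
  rcases x with p | p
  · exact h p
  · exact absurd ⟨p, rfl⟩ hx

lemma hasSumR_inl {f : Idx → ℝ} (h : ∀ p, f (Sum.inr p) = 0) (a : ℝ) :
    HasSum (fun p => f (Sum.inl p)) a ↔ HasSum f a := by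
  refine Sum.inl_injective.hasSum_iff (f := f) fun x hx => ?_
  rcases x with p | p
  · exact absurd ⟨p, rfl⟩ hx
  · exact h p

lemma hasSumR_inr {f : Idx → ℝ} (h : ∀ p, f (Sum.inl p) = 0) (a : ℝ) :
    HasSum (fun p => f (Sum.inr p)) a ↔ HasSum f a := by
  refine Sum.inr_injective.hasSum_iff (f := f) fun x hx => ?_
  rcases x with p | p
  · exact h p
  · exact absurd ⟨p, rfl⟩ hx

lemma VV_col (α : ℂ) {c : ℤ × ℤ → ℂ} (hc : Rapid (fun p => lam p + Kpt) c) (k : ℕ) (j : Idx) :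
    HasSum (fun i => (1 + ‖mu i - mu j‖) ^ k * ‖VV α c i j‖)
      (‖α‖ * ∑' p, (1 + ‖lam p + Kpt‖) ^ k * ‖c p‖) := by
  have h0 := (hc k).hasSum.mul_left ‖α‖
  rcases j with r | r
  · rw [← hasSumR_inr (by intro p; simp [VV])]
    have h1 := (Equiv.subLeft r).hasSum_iff.2 h0
    refine h1.congr_fun fun p => ?_
    simp only [Function.comp, mu, VV, Equiv.subLeft_apply, lam_sub, norm_mul]
    rw [show lam p - (lam r + Kpt) = -(lam r - lam p + Kpt) by ring, norm_neg]
    ring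
  · rw [← hasSumR_inl (by intro p; simp [VV])]
    have h1 := (Equiv.subRight r).hasSum_iff.2 h0
    refine h1.congr_fun fun p => ?_
    simp only [Function.comp, mu, VV, Equiv.subRight_apply, lam_sub, norm_mul]
    rw [show lam p + Kpt - lam r = lam p - lam r + Kpt by ring]
    ring

lemma lam_zero : lam 0 = 0 := by
  apply Complex.ext <;> simp [lam]

lemma mu_zero (i : Idx) : mu i = 0 ↔ i = Sum.inr 0 := by
  rcases i with p | p
  · simp only [mu, reduceCtorEq, iff_false]
    intro h
    have h1 := congrArg Complex.re h
    simp only [Complex.add_re, lam, K_re, Complex.zero_re] at h1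
    have h2 : (3 * p.1 + 2 : ℝ) = 0 := by
      have h3 : Real.pi * (3 * p.1 + 2 : ℝ) = 0 := by linarith
      exact (mul_eq_zero.1 h3).resolve_left Real.pi_ne_zero
    have h4 : 3 * p.1 + 2 = 0 := by exact_mod_cast h2
    omega
  · simp only [mu, Sum.inr.injEq]
    constructor
    · intro h
      obtain ⟨h1, h2⟩ := lam_lower p
      rw [h, norm_zero] at h1 h2
      have h1' := abs_nonpos_iff.1 h1
      have h2' := abs_nonpos_iff.1 h2
      ext
      · exact_mod_cast h1'
      · exact_mod_cast h2'
    · rintro rfl; exact lam_zero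

lemma mu_finite (R : ℝ) : {i : Idx | ‖mu i‖ ≤ R}.Finite := by
  refine (((lam_finite Kpt R).image Sum.inl).union ((lam_finite 0 R).image Sum.inr)).subset ?_
  intro i hi
  rcases i with p | p
  · exact Or.inl ⟨p, hi, rfl⟩
  · refine Or.inr ⟨p, ?_, rfl⟩
    have h : ‖mu (Sum.inr p)‖ ≤ R := hi
    show ‖lam p + 0‖ ≤ R
    rw [add_zero]; exact h

lemma ser_zero {f : ℤ × ℤ → ℂ} {w : ℂ} (hf : Rapid (fun p => lam p + w) f)
    (h : ∀ z, ser (fun p => lam p + w) f z = 0) (p : ℤ × ℤ) : f p = 0 := by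
  refine ee_unique2 f hf.summable (fun s t => ?_) p
  have h1 := ser_hasSum hf ((s : ℂ) + t * ω)
  rw [h] at h1
  have h2 := h1.mul_right (pw (-w) ((s : ℂ) + t * ω))
  rw [zero_mul] at h2
  refine h2.congr_fun fun p => ?_
  rw [mul_assoc, ← pw_add, add_neg_cancel_right, pw_lam]

lemma ser_translate (f : ℤ × ℤ → ℂ) (w : ℂ) {γ : ℂ} (hγ : γ ∈ Lam) (z : ℂ) :
    ser (fun p => lam p + w) f (z + γ) = pw w γ * ser (fun p => lam p + w) f z := by
  unfold ser
  rw [← tsum_mul_left]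
  congr 1
  ext p
  rw [pw_add_right, pw_add _ _ γ, pw_lam_Lam hγ]
  ring

lemma rapid_inl {g : Idx → ℂ} (h : ∀ k : ℕ, Summable fun i => (1 + ‖mu i‖) ^ k * ‖g i‖) :
    Rapid (fun p => lam p + Kpt) (fun p => g (Sum.inl p)) := by
  intro k
  have h1 := Summable.comp_injective (h k) (i := (Sum.inl : ℤ × ℤ → Idx)) Sum.inl_injective
  exact h1.congr fun p => rfl

lemma rapid_inr {g : Idx → ℂ} (h : ∀ k : ℕ, Summable fun i => (1 + ‖mu i‖) ^ k * ‖g i‖) :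
    Rapid lam (fun p => g (Sum.inr p)) := by
  intro k
  have h1 := Summable.comp_injective (h k) (i := (Sum.inr : ℤ × ℤ → Idx)) Sum.inr_injective
  exact h1.congr fun p => rfl

set_option maxHeartbeats 1000000 in
lemma main_K {U : ℂ → ℂ} (hU : IsPotential U) (α : ℂ) :
    ∃ u : ℂ → ℂ × ℂ, ContDiff ℝ (⊤ : ℕ∞) u ∧ (∃ z, u z ≠ 0) ∧ BC u ∧
        ∀ z : ℂ, Dop U α u z = Kpt • u z := by
  obtain ⟨c, hc, hrho, hs⟩ := potential_sym hU
  obtain ⟨g, hg, ⟨i1, hi1⟩, heq⟩ := discrete_index mu sig ω omega_ne_zero omega_ne_one (VV α c)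
    (by
      rintro (p | p)
      · exact lam_rho p
      · exact lam_tau p)
    (by
      rintro (p | p) (r | r)
      · simp [sig, VV]
      · simp only [sig, Equiv.sumCongr_apply, Sum.map_inl, Sum.map_inr, VV, rho_sub_tau, hrho]
        ring
      · simp only [sig, Equiv.sumCongr_apply, Sum.map_inl, Sum.map_inr, VV, rho_sub_tau, hrho]
        ring
      · simp [sig, VV])
    (Sum.inr 0) mu_zero mu_finite (‖α‖ * ∑' p, (1 + ‖lam p + Kpt‖) ^ 0 * ‖c p‖)
    (fun j => by simpa using (VV_col α hc 0 j).summable)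
    (fun j => by simpa using (VV_col α hc 0 j).tsum_eq.le)
  have hrap := bootstrap mu (VV α c) g hg heq
    (fun k => ⟨_, fun j => ⟨(VV_col α hc k j).summable, (VV_col α hc k j).tsum_eq.le⟩⟩)
  let a : ℤ × ℤ → ℂ := fun p => g (Sum.inl p)
  let b : ℤ × ℤ → ℂ := fun p => g (Sum.inr p)
  have ha : Rapid (fun p => lam p + (Kpt + Kpt)) a := by
    have h : Rapid (fun p => lam p + Kpt) a := rapid_inl hrap
    have h' := h.shift Kpt
    simpa only [add_assoc] using h'
  have hb : Rapid (fun p => lam p + Kpt) b := by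
    have h : Rapid lam b := rapid_inr hrap
    exact h.shift Kpt
  have eqa : ∀ p, HasSum (fun r => α * c (p - r) * b r) (-((lam p + Kpt) * a p)) := fun p =>
    (hasSum_inr (f := fun j => VV α c (Sum.inl p) j * g j) (by intro r; simp [VV]) _).2
      (heq (Sum.inl p))
  have eqb : ∀ p, HasSum (fun r => α * c (r - p) * a r) (-(lam p * b p)) := fun p =>
    (hasSum_inl (f := fun j => VV α c (Sum.inr p) j * g j) (by intro r; simp [VV]) _).2
      (heq (Sum.inr p))
  let u1 := ser (fun p => lam p + (Kpt + Kpt)) a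
  let u2 := ser (fun p => lam p + Kpt) b
  refine ⟨fun z => (u1 z, u2 z), (ser_contDiff ha).prodMk (ser_contDiff hb), ?_, ?_, ?_⟩
  · by_contra hcon
    push Not at hcon
    have z1 : ∀ z, u1 z = 0 := fun z => congrArg Prod.fst (hcon z)
    have z2 : ∀ z, u2 z = 0 := fun z => congrArg Prod.snd (hcon z)
    rcases i1 with p | p
    · exact hi1 (ser_zero ha z1 p)
    · exact hi1 (ser_zero hb z2 p)
  · intro γ hγ z
    have e1 : Complex.exp (-Complex.I * (pairing γ Kpt : ℂ)) = pw (Kpt + Kpt) γ := by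
      have h1 : Complex.exp (-Complex.I * (pairing γ Kpt : ℂ)) * pw Kpt γ = 1 := by
        rw [pw, ← Complex.exp_add]; simp
      have h2 := pw_K_cube hγ
      rw [pw_add]
      linear_combination (pw Kpt γ * pw Kpt γ) * h1 -
        Complex.exp (-Complex.I * (pairing γ Kpt : ℂ)) * h2
    refine Prod.ext ?_ ?_
    · simp only [e1]
      exact ser_translate a (Kpt + Kpt) hγ z
    · exact ser_translate b Kpt hγ z
  · intro z
    have hxs : ∀ w : ℂ, Summable fun p => ‖c p * pw (lam p + Kpt) w‖ := fun w => by
      simpa [pw_norm] using hc.summable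
    have f1 : HasSum (fun p => -((lam p + Kpt) * a p) * pw (lam p + (Kpt + Kpt)) z)
        (α * U z * u2 z) := by
      rw [mul_assoc]
      have := conv_sum (fun p => α * (c p * pw (lam p + Kpt) z)) (fun p => b p * pw (lam p + Kpt) z)
        (fun p => -((lam p + Kpt) * a p) * pw (lam p + (Kpt + Kpt)) z) (α * U z) (u2 z)
        (by simpa [pw_norm] using hc.summable.mul_left ‖α‖) (by simpa [pw_norm] using hb.summable)
        ((hs z).mul_left α) (ser_hasSum hb z) shear1 (fun p => by
          refine ((eqa p).mul_right _).congr_fun fun r => ?_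
          simp only [shear1, Equiv.coe_fn_mk]
          have : pw (lam (p - r) + Kpt) z * pw (lam r + Kpt) z = pw (lam p + (Kpt + Kpt)) z := by
            rw [← pw_add, lam_sub]; congr 1; ring
          rw [← this]; ring)
      rwa [mul_assoc] at this
    have f2 : HasSum (fun p => -(lam p * b p) * pw (lam p + Kpt) z)
        (α * U (-z) * u1 z) := by
      exact conv_sum (fun p => α * (c p * pw (lam p + Kpt) (-z)))
        (fun p => a p * pw (lam p + (Kpt + Kpt)) z)
        (fun p => -(lam p * b p) * pw (lam p + Kpt) z) (α * U (-z)) (u1 z)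
        (by simpa [pw_norm] using hc.summable.mul_left ‖α‖) (by simpa [pw_norm] using ha.summable)
        ((hs (-z)).mul_left α) (ser_hasSum ha z) shear2 (fun p => by
          refine ((eqb p).mul_right _).congr_fun fun r => ?_
          simp only [shear2, Equiv.coe_fn_mk]
          have : pw (lam (r - p) + Kpt) (-z) * pw (lam r + (Kpt + Kpt)) z = pw (lam p + Kpt) z := by
            rw [pw_neg, ← pw_add, lam_sub]; congr 1; ring
          rw [← this]; ring)
    have d1 := ser_twoDbar ha z
    have d2 := ser_twoDbar hb z
    refine Prod.ext ?_ ?_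
    · refine (d1.add f1).unique (((ser_hasSum ha z).mul_left Kpt).congr_fun fun p => ?_)
      ring
    · refine (f2.add d2).unique (((ser_hasSum hb z).mul_left Kpt).congr_fun fun p => ?_)
      ring

lemma twoDbar_neg (w : ℂ → ℂ) (z : ℂ) : twoDbar (fun x => w (-x)) z = -twoDbar w (-z) := by
  have h : fderiv ℝ (fun x => w (-x)) z = -fderiv ℝ w (-z) := by
    have := fderiv_comp_smul (𝕜 := ℝ) (f := w) (x := z) (-1)
    simpa using this
  rw [twoDbar, twoDbar, h]
  simp only [_root_.neg_apply]
  ring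

/-- protected Dirac points — for every α, both K and −K are eigenvalues of
D(α) on L²₀. -/
theorem stmt16 (U : ℂ → ℂ) (hUpot : IsPotential U) :
    ∀ α : ℂ, ∀ k ∈ ({Kpt, -Kpt} : Set ℂ),
      ∃ u : ℂ → ℂ × ℂ, ContDiff ℝ (⊤ : ℕ∞) u ∧ (∃ z, u z ≠ 0) ∧ BC u ∧
        ∀ z : ℂ, Dop U α u z = k • u z := by
  intro α k hk
  rcases hk with rfl | hk
  · exact main_K hUpot α
  · have hk' : k = -Kpt := hk
    subst hk'
    obtain ⟨u, hu, ⟨z0, hz0⟩, hbc, hD⟩ := main_K hUpot (-α)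
    refine ⟨fun z => ((u (-z)).2, (u (-z)).1), ?_, ⟨-z0, ?_⟩, ?_, ?_⟩
    · have h := hu.comp (contDiff_neg (𝕜 := ℝ) (F := ℂ) (n := (⊤ : ℕ∞)))
      exact h.snd.prodMk h.fst
    · intro h
      apply hz0
      have h1 := congrArg Prod.fst h
      have h2 := congrArg Prod.snd h
      simp only [neg_neg] at h1 h2
      exact Prod.ext h2 h1
    · intro γ hγ z
      have hγ' : -γ ∈ Lam := by
        obtain ⟨m, n, rfl⟩ := hγ
        exact ⟨-m, -n, by push_cast; ring⟩
      have h := hbc (-γ) hγ' (-z)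
      have hp : pairing (-γ) Kpt = - pairing γ Kpt := by simp [pairing]
      simp only [neg_add, h, hp]
      push_cast
      simp only [mul_neg, neg_mul, neg_neg]
    · intro z
      have h := hD (-z)
      have h1 := congrArg Prod.fst h
      have h2 := congrArg Prod.snd h
      simp only [Dop, Prod.smul_fst, Prod.smul_snd, smul_eq_mul, neg_neg] at h1 h2
      refine Prod.ext ?_ ?_
      · simp only [Dop, Prod.smul_fst, smul_eq_mul]
        rw [twoDbar_neg (fun w => (u w).2) z]
        linear_combination -h2
      · simp only [Dop, Prod.smul_snd, smul_eq_mul]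
        rw [twoDbar_neg (fun w => (u w).1) z]
        linear_combination -h1
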